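/- For every c > 0 there exist K = K(c) > 0 and n_0 such that the following holds for all n ≥ n_0, all γ ∈ [−1,1], and every pair of partitions [2n] = A_1 ∪ A_2 = B_1 ∪ B_2 with |A_1| = |A_2| = |B_1| = |B_2| = n and c·n ≤ |A_1 ∩ B_1| ≤ (1−c)·n: for G ∼ G(2n,1/2), letting E_var be the event that Σ_{v∈[2n]} (deg(v,S) − |S|/2)² ≤ K·n² for every subset S ⊆ [2n], one has P[E_var | E_2] ≥ 1 − exp(−n). -/

import Mathlib

/-- The probability, under the uniform measure on labeled graphs on `Fin n`
(equivalently under `G(n,1/2)`), of a graph property `P`. -/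
noncomputable def graphProb (n : ℕ) (P : SimpleGraph (Fin n) → Prop) : ℝ :=
  (Nat.card {G : SimpleGraph (Fin n) // P G} : ℝ) / 2 ^ n.choose 2

/-- `deg(v,S)`: the number of neighbors of `v` inside the vertex set `S`. -/
noncomputable def degIn {n : ℕ} (G : SimpleGraph (Fin n)) (v : Fin n)
    (S : Finset (Fin n)) : ℕ :=
  Nat.card {w : Fin n // w ∈ S ∧ G.Adj v w}

/-- The friendliness event for the partition `A ∪ Aᶜ` with margin `t`: every vertex has
at least `t` more neighbours in its own part than in the other part. -/
def FriendlyPair {m : ℕ} (G : SimpleGraph (Fin m)) (A : Finset (Fin m)) (t : ℝ) : Prop :=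
  (∀ v ∈ A, (degIn G v Aᶜ : ℝ) + t ≤ (degIn G v A : ℝ)) ∧
  (∀ v ∈ (Aᶜ : Finset (Fin m)), (degIn G v A : ℝ) + t ≤ (degIn G v Aᶜ : ℝ))

section

open Finset

/-- The `±1` indicator of membership of `e` in `T`. -/
noncomputable def rademacher {E : Type} [DecidableEq E] (T : Finset E) (e : E) : ℝ :=
  if e ∈ T then 1 else -1

lemma sum_exp_rademacher {E : Type} [Fintype E] [DecidableEq E] (a : E → ℝ) :
    ∑ T : Finset E, Real.exp (∑ e, a e * rademacher T e) = ∏ e, (2 * Real.cosh (a e)) := by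
  have h : ∀ e, 2 * Real.cosh (a e) = Real.exp (a e) + Real.exp (-a e) := fun e => by
    rw [Real.cosh_eq]; ring
  simp_rw [h]
  rw [Fintype.prod_add]
  refine sum_congr rfl fun T _ => ?_
  rw [Real.exp_sum, ← prod_mul_prod_compl T]
  congr 1
  · exact prod_congr rfl fun e he => by simp [rademacher, he]
  · exact prod_congr rfl fun e he => by simp [rademacher, mem_compl.1 he]

lemma sum_exp_rademacher_le {E : Type} [Fintype E] [DecidableEq E] (a : E → ℝ) :
    ∑ T : Finset E, Real.exp (∑ e, a e * rademacher T e) ≤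
      2 ^ Fintype.card E * Real.exp ((∑ e, a e ^ 2) / 2) := by
  rw [sum_exp_rademacher, prod_mul_distrib, prod_const, card_univ, sum_div, Real.exp_sum]
  gcongr with e
  exact Real.cosh_le_exp_half_sq _

lemma summable_exp_neg_sq_div_eight : Summable fun t : ℤ => Real.exp (-(t : ℝ) ^ 2 / 8) := by
  have key : Summable fun n : ℕ => Real.exp (1 / 8) * Real.exp (-(1 / 4)) ^ n :=
    (summable_geometric_of_lt_one (Real.exp_pos _).le
      (by rw [Real.exp_lt_one_iff]; norm_num)).mul_left _
  have hle : ∀ n : ℕ, Real.exp (-(n : ℝ) ^ 2 / 8) ≤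
      Real.exp (1 / 8) * Real.exp (-(1 / 4)) ^ n := fun n => by
    rw [← Real.exp_nat_mul, ← Real.exp_add]
    apply Real.exp_le_exp.2
    nlinarith [sq_nonneg ((n : ℝ) - 1)]
  refine Summable.of_nat_of_neg ?_ ?_
  · exact Summable.of_nonneg_of_le (fun _ => (Real.exp_pos _).le)
      (fun n => by simpa using hle n) key
  · exact Summable.of_nonneg_of_le (fun _ => (Real.exp_pos _).le)
      (fun n => by simpa using hle n) key

/-- A constant bounding the one-dimensional lattice Gaussian sums used below. -/
noncomputable def latticeConst : ℝ :=
  Real.exp (1 / 16) * ∑' t : ℤ, Real.exp (-(t : ℝ) ^ 2 / 8)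

lemma one_le_tsum_exp_neg_sq : 1 ≤ ∑' t : ℤ, Real.exp (-(t : ℝ) ^ 2 / 8) := by
  have := summable_exp_neg_sq_div_eight.le_tsum 0 (fun _ _ => (Real.exp_pos _).le)
  simpa using this

lemma one_le_latticeConst : 1 ≤ latticeConst :=
  one_le_mul_of_one_le_of_one_le (Real.one_le_exp (by norm_num)) one_le_tsum_exp_neg_sq

lemma sum_exp_neg_sq_le {V : Type} [Fintype V] [DecidableEq V] (Q : Finset (V → ℤ)) :
    ∑ k ∈ Q, Real.exp (-(∑ v, (k v : ℝ) ^ 2) / 8) ≤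
      (∑' t : ℤ, Real.exp (-(t : ℝ) ^ 2 / 8)) ^ Fintype.card V := by
  calc ∑ k ∈ Q, Real.exp (-(∑ v, (k v : ℝ) ^ 2) / 8)
      = ∑ k ∈ Q, ∏ v, Real.exp (-(k v : ℝ) ^ 2 / 8) := by
        refine sum_congr rfl fun k _ => ?_
        rw [← Real.exp_sum, ← sum_div, sum_neg_distrib]
    _ ≤ ∑ k ∈ Fintype.piFinset (fun v => Q.image (fun k : V → ℤ => k v)),
          ∏ v, Real.exp (-(k v : ℝ) ^ 2 / 8) := by
        refine sum_le_sum_of_subset_of_nonneg (fun k hk => ?_)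
          fun _ _ _ => prod_nonneg fun _ _ => (Real.exp_pos _).le
        exact Fintype.mem_piFinset.2 fun v => mem_image_of_mem _ hk
    _ = ∏ v, ∑ t ∈ Q.image (fun k : V → ℤ => k v), Real.exp (-(t : ℝ) ^ 2 / 8) :=
        (prod_univ_sum (fun v => Q.image (fun k : V → ℤ => k v))
          (fun _ (t : ℤ) => Real.exp (-(t : ℝ) ^ 2 / 8))).symm
    _ ≤ ∏ _v : V, ∑' t : ℤ, Real.exp (-(t : ℝ) ^ 2 / 8) :=
        prod_le_prod (fun _ _ => sum_nonneg fun _ _ => (Real.exp_pos _).le) fun v _ =>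
          summable_exp_neg_sq_div_eight.sum_le_tsum _ fun _ _ => (Real.exp_pos _).le
    _ = _ := by rw [prod_const, card_univ]

lemma card_lattice_ball_le {V : Type} [Fintype V] [DecidableEq V] (Q : Finset (V → ℤ)) (R : ℝ)
    (hQ : ∀ k ∈ Q, ∑ v, (k v : ℝ) ^ 2 ≤ R) :
    (Q.card : ℝ) ≤ Real.exp (R / 8) * latticeConst ^ Fintype.card V := by
  calc (Q.card : ℝ) = ∑ k ∈ Q, (1 : ℝ) := by simp
    _ ≤ ∑ k ∈ Q, Real.exp (R / 8) * Real.exp (-(∑ v, (k v : ℝ) ^ 2) / 8) := by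
        refine sum_le_sum fun k hk => ?_
        rw [← Real.exp_add]
        exact Real.one_le_exp (by linarith [hQ k hk])
    _ = Real.exp (R / 8) * ∑ k ∈ Q, Real.exp (-(∑ v, (k v : ℝ) ^ 2) / 8) := by rw [mul_sum]
    _ ≤ _ := by
        gcongr
        refine (sum_exp_neg_sq_le Q).trans ?_
        gcongr
        exact le_mul_of_one_le_left (by linarith [one_le_tsum_exp_neg_sq])
          (Real.one_le_exp (by norm_num))

/-- Exponential tail for the squared length of a vector of Rademacher sums whose coefficient
matrix has operator norm at most one. -/
lemma card_lt_sum_sq_rademacher_le {E V : Type} [Fintype E] [DecidableEq E] [Fintype V]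
    [DecidableEq V] (a : V → E → ℝ)
    (ha : ∀ t : V → ℝ, ∑ e, (∑ v, t v * a v e) ^ 2 ≤ ∑ v, t v ^ 2) (K : ℝ) :
    ((univ.filter fun T : Finset E => K < ∑ v, (∑ e, a v e * rademacher T e) ^ 2).card : ℝ) ≤
      2 ^ Fintype.card E * (Real.exp (-K / 4) * latticeConst ^ Fintype.card V) := by
  set u : Finset E → V → ℝ := fun T v => ∑ e, a v e * rademacher T e with hu
  set Q : Finset (V → ℤ) := univ.image fun T v => round (u T v) with hQ
  have hpt : ∀ T, Real.exp ((∑ v, u T v ^ 2) / 4) ≤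
      ∑ k ∈ Q, Real.exp (Fintype.card V / 16 - (∑ v, (k v : ℝ) ^ 2) / 4) *
        Real.exp (∑ e, (∑ v, (k v / 2 : ℝ) * a v e) * rademacher T e) := by
    intro T
    have hmem : (fun v => round (u T v)) ∈ Q := mem_image_of_mem _ (mem_univ T)
    refine le_trans ?_ (single_le_sum (f := fun k : V → ℤ =>
      Real.exp (Fintype.card V / 16 - (∑ v, (k v : ℝ) ^ 2) / 4) *
        Real.exp (∑ e, (∑ v, (k v / 2 : ℝ) * a v e) * rademacher T e))
      (fun k _ => by positivity) hmem)
    rw [← Real.exp_add]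
    apply Real.exp_le_exp.2
    have h1 : ∑ e, (∑ v, ((round (u T v) : ℤ) / 2 : ℝ) * a v e) * rademacher T e =
        ∑ v, ((round (u T v) : ℤ) / 2 : ℝ) * u T v := by
      simp_rw [sum_mul, hu, mul_sum]
      rw [sum_comm]
      exact sum_congr rfl fun v _ => sum_congr rfl fun e _ => by ring
    have h2 : (Fintype.card V : ℝ) / 16 = ∑ _v : V, (1 / 16 : ℝ) := by
      simp [div_eq_mul_inv]
    rw [h1, h2, sum_div, sum_div, ← sum_sub_distrib, ← sum_add_distrib]
    refine sum_le_sum fun v _ => ?_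
    have := abs_le.1 (abs_sub_round (u T v))
    nlinarith [this.1, this.2]
  have hsum : ∑ T, Real.exp ((∑ v, u T v ^ 2) / 4) ≤
      2 ^ Fintype.card E * latticeConst ^ Fintype.card V := by
    calc ∑ T, Real.exp ((∑ v, u T v ^ 2) / 4)
        ≤ ∑ T : Finset E, ∑ k ∈ Q,
            Real.exp (Fintype.card V / 16 - (∑ v, (k v : ℝ) ^ 2) / 4) *
            Real.exp (∑ e, (∑ v, (k v / 2 : ℝ) * a v e) * rademacher T e) :=
          sum_le_sum fun T _ => hpt T
      _ = ∑ k ∈ Q, Real.exp (Fintype.card V / 16 - (∑ v, (k v : ℝ) ^ 2) / 4) *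
            ∑ T : Finset E,
            Real.exp (∑ e, (∑ v, (k v / 2 : ℝ) * a v e) * rademacher T e) := by
          rw [sum_comm]; simp_rw [mul_sum]
      _ ≤ ∑ k ∈ Q, Real.exp (Fintype.card V / 16 - (∑ v, (k v : ℝ) ^ 2) / 4) *
            (2 ^ Fintype.card E * Real.exp ((∑ v, (k v / 2 : ℝ) ^ 2) / 2)) := by
          gcongr with k
          refine (sum_exp_rademacher_le _).trans ?_
          gcongr
          exact ha _
      _ = 2 ^ Fintype.card E * Real.exp (Fintype.card V / 16) *
            ∑ k ∈ Q, Real.exp (-(∑ v, (k v : ℝ) ^ 2) / 8) := by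
          rw [mul_sum]
          refine sum_congr rfl fun k _ => ?_
          rw [mul_left_comm, ← Real.exp_add, mul_assoc, ← Real.exp_add]
          simp_rw [div_pow, ← sum_div]
          congr 2
          ring
      _ ≤ 2 ^ Fintype.card E * Real.exp (Fintype.card V / 16) *
            (∑' t : ℤ, Real.exp (-(t : ℝ) ^ 2 / 8)) ^ Fintype.card V := by
          gcongr
          exact sum_exp_neg_sq_le Q
      _ = _ := by
          rw [latticeConst, mul_pow, ← Real.exp_nat_mul, mul_assoc]
          congr 3
          ring_nf
  have hmarkov : ((univ.filter fun T : Finset E => K < ∑ v, u T v ^ 2).card : ℝ) *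
      Real.exp (K / 4) ≤ ∑ T, Real.exp ((∑ v, u T v ^ 2) / 4) := by
    rw [← nsmul_eq_mul, ← sum_const]
    refine (sum_le_sum fun T hT => ?_).trans
      (sum_le_sum_of_subset_of_nonneg (filter_subset _ _) fun _ _ _ => (Real.exp_pos _).le)
    exact Real.exp_le_exp.2 (by linarith [(mem_filter.1 hT).2])
  have h4 : Real.exp (-K / 4) = (Real.exp (K / 4))⁻¹ := by rw [← Real.exp_neg]; ring_nf
  rw [h4, mul_left_comm, ← div_eq_inv_mul, le_div_iff₀ (Real.exp_pos _)]
  exact hmarkov.trans hsum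

lemma sq_card_le_card_image_mul_collisions {α β : Type} [DecidableEq α] [DecidableEq β]
    (s : Finset α) (f : α → β) :
    s.card ^ 2 ≤ (s.image f).card * ((s ×ˢ s).filter fun x => f x.1 = f x.2).card := by
  have h : ((s ×ˢ s).filter fun x => f x.1 = f x.2).card =
      ∑ b ∈ s.image f, (s.filter fun a => f a = b).card ^ 2 := by
    rw [card_eq_sum_card_fiberwise (f := fun x => f x.1) (t := s.image f)]
    · refine sum_congr rfl fun b _ => ?_
      rw [sq, ← card_product]
      congr 1
      ext ⟨x, y⟩
      simp only [mem_filter, mem_product]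
      constructor
      · rintro ⟨⟨⟨hx, hy⟩, h1⟩, h2⟩
        exact ⟨⟨hx, h2⟩, hy, h1 ▸ h2⟩
      · rintro ⟨⟨hx, h1⟩, hy, h2⟩
        exact ⟨⟨⟨hx, hy⟩, h1.trans h2.symm⟩, h1⟩
    · intro x hx
      have hx' := mem_filter.1 (mem_coe.1 hx)
      exact mem_coe.2 (mem_image_of_mem f (mem_product.1 hx'.1).1)
  rw [h, card_eq_sum_card_image f s]
  exact sq_sum_le_card_mul_sum_sq

/-- The four-cycle case of Sidorenko's inequality, for the bipartite graph whose edges are the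
elements `x` of `s` joining `f x` to `g x`. -/
lemma pow_four_card_le_four_cycles {α β γ : Type} [DecidableEq α] [DecidableEq β]
    [DecidableEq γ] (s : Finset α) (f : α → β) (g : α → γ) :
    s.card ^ 4 ≤ (s.image f).card ^ 2 * (s.image g).card ^ 2 *
      (((s ×ˢ s) ×ˢ (s ×ˢ s)).filter fun x => g x.1.1 = g x.1.2 ∧ g x.2.1 = g x.2.2 ∧
        f x.1.1 = f x.2.1 ∧ f x.1.2 = f x.2.2).card := by
  set P := (s ×ˢ s).filter fun x => g x.1 = g x.2 with hP
  have h1 := sq_card_le_card_image_mul_collisions s g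
  have h2 := sq_card_le_card_image_mul_collisions P (fun x => (f x.1, f x.2))
  have h3 : (P.image fun x => (f x.1, f x.2)).card ≤ (s.image f).card ^ 2 := by
    rw [sq, ← card_product]
    refine card_le_card fun y hy => ?_
    obtain ⟨x, hx, rfl⟩ := mem_image.1 hy
    have := mem_product.1 (mem_filter.1 hx).1
    exact mem_product.2 ⟨mem_image_of_mem f this.1, mem_image_of_mem f this.2⟩
  have h4 : (P ×ˢ P).filter (fun x => (f x.1.1, f x.1.2) = (f x.2.1, f x.2.2)) ⊆
      ((s ×ˢ s) ×ˢ (s ×ˢ s)).filter fun x => g x.1.1 = g x.1.2 ∧ g x.2.1 = g x.2.2 ∧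
        f x.1.1 = f x.2.1 ∧ f x.1.2 = f x.2.2 := by
    intro x hx
    simp only [hP, mem_filter, mem_product, Prod.mk.injEq] at hx ⊢
    tauto
  calc s.card ^ 4 = (s.card ^ 2) ^ 2 := by ring
    _ ≤ ((s.image g).card * P.card) ^ 2 := by gcongr
    _ = (s.image g).card ^ 2 * P.card ^ 2 := by ring
    _ ≤ (s.image g).card ^ 2 * ((s.image f).card ^ 2 * _) := by
        gcongr
        exact h2.trans (Nat.mul_le_mul h3 (card_le_card h4))
    _ = _ := by ring

lemma one_add_sq_div_two_le_cosh (x : ℝ) : 1 + x ^ 2 / 2 ≤ Real.cosh x := by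
  have h : Real.cosh x = 1 + 2 * Real.sinh (x / 2) ^ 2 := by
    have h1 := Real.cosh_two_mul (x / 2)
    have h2 := Real.cosh_sq (x / 2)
    rw [show 2 * (x / 2) = x by ring] at h1
    linarith
  have h2 : (x / 2) ^ 2 ≤ Real.sinh (x / 2) ^ 2 := by
    rw [sq_le_sq, Real.abs_sinh]
    exact Real.self_le_sinh_iff.2 (abs_nonneg _)
  rw [h]
  nlinarith

/-- A Rademacher sum of length `d` exceeds any fixed multiple of `√d` with probability bounded
away from zero. -/
lemma exists_le_card_rademacher_ge (C : ℝ) (hC : 0 < C) :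
    ∃ δ : ℝ, 0 < δ ∧ ∃ d₀ : ℕ, ∀ (E : Type) [Fintype E] [DecidableEq E] (F : Finset E),
      d₀ ≤ F.card → 2 ^ Fintype.card E * δ ≤
        ((univ.filter fun T : Finset E =>
          C * Real.sqrt F.card ≤ ∑ e ∈ F, rademacher T e).card : ℝ) := by
  set B : ℝ := 4 * C + 4 with hB
  have hBpos : 0 < B := by positivity
  refine ⟨Real.exp (-2 * B ^ 2) / 4, by positivity, ⌈B ^ 2⌉₊ + 1, ?_⟩
  intro E _ _ F hF
  set d := F.card with hd
  have hdB : B ^ 2 ≤ d := by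
    have h1 : (⌈B ^ 2⌉₊ : ℝ) ≤ d := by exact_mod_cast (Nat.le_succ _).trans hF
    exact (Nat.le_ceil _).trans h1
  have hdpos : (0 : ℝ) < d := lt_of_lt_of_le (by positivity) hdB
  set r := Real.sqrt d with hr
  have hrpos : 0 < r := Real.sqrt_pos.2 hdpos
  have hr2 : r ^ 2 = d := Real.sq_sqrt hdpos.le
  set l := B / r with hl
  have hlpos : 0 < l := by positivity
  have hld : l ^ 2 * d = B ^ 2 := by rw [hl, ← hr2]; field_simp
  have hl1 : l ^ 2 ≤ 1 := by
    by_contra hcon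
    push Not at hcon
    nlinarith
  set S : Finset E → ℝ := fun T => ∑ e ∈ F, rademacher T e with hS
  have hmgf : ∀ m : ℝ, ∑ T : Finset E, Real.exp (m * S T) =
      2 ^ Fintype.card E * Real.cosh m ^ d := by
    intro m
    have h1 : ∀ T : Finset E, m * S T = ∑ e, (if e ∈ F then m else 0) * rademacher T e := by
      intro T
      simp_rw [hS, mul_sum, ite_mul, zero_mul]
      rw [← sum_filter]
      simp
    simp_rw [h1]
    rw [sum_exp_rademacher, prod_mul_distrib, prod_const, card_univ]
    congr 1
    rw [← prod_subset (subset_univ F)]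
    · rw [hd, ← prod_const]
      exact prod_congr rfl fun e he => by simp [he]
    · intro e _ he
      simp [he]
  set M := Real.cosh l ^ d with hM
  have hM1 : 1 ≤ M := one_le_pow₀ (Real.one_le_cosh l)
  set W := univ.filter fun T : Finset E => M / 2 ≤ Real.exp (l * S T) with hW
  have hWle : (W.card : ℝ) ≤ ((univ.filter fun T : Finset E => C * r ≤ S T).card : ℝ) := by
    have : W ⊆ univ.filter fun T : Finset E => C * r ≤ S T := by
      intro T hT
      refine mem_filter.2 ⟨mem_univ _, ?_⟩
      have hT' := (mem_filter.1 hT).2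
      have h1 : Real.exp (B ^ 2 / 4 - 1) ≤ Real.exp (l * S T) := by
        refine le_trans ?_ hT'
        have h2 : Real.exp (l ^ 2 / 4) ≤ Real.cosh l := by
          refine le_trans ?_ (one_add_sq_div_two_le_cosh l)
          have := Real.abs_exp_sub_one_sub_id_le (x := l ^ 2 / 4)
            (by rw [abs_of_nonneg (by positivity)]; linarith)
          have h3 := (abs_le.1 this).2
          nlinarith [sq_nonneg l]
        have h3 : Real.exp (B ^ 2 / 4) ≤ M := by
          rw [hM, ← hld]
          calc Real.exp (l ^ 2 * d / 4) = Real.exp (l ^ 2 / 4) ^ d := by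
                rw [← Real.exp_nat_mul]; ring_nf
            _ ≤ _ := by gcongr
        rw [Real.exp_sub]
        have h4 : (2 : ℝ) ≤ Real.exp 1 := by
          have := Real.add_one_le_exp 1
          linarith
        gcongr
      have h5 := Real.exp_le_exp.1 h1
      have h6 : r * (B ^ 2 / 4 - 1) ≤ B * S T := by
        have : r * (l * S T) = B * S T := by rw [hl]; field_simp
        rw [← this]; gcongr
      have h7 : B * (C * r) ≤ B * S T := by
        refine le_trans ?_ h6
        have : B * C ≤ B ^ 2 / 4 - 1 := by rw [hB]; nlinarith
        nlinarith
      exact le_of_mul_le_mul_left h7 hBpos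
    exact_mod_cast card_le_card this
  refine le_trans ?_ hWle
  set P : ℝ := 2 ^ Fintype.card E with hP
  have hPpos : 0 < P := by positivity
  have hsplit : P * M ≤ P * (M / 2) + ∑ T ∈ W, Real.exp (l * S T) := by
    rw [← hmgf l, ← sum_filter_add_sum_filter_not univ
      (fun T : Finset E => M / 2 ≤ Real.exp (l * S T)), add_comm]
    gcongr
    calc ∑ T ∈ univ.filter (fun T : Finset E => ¬ M / 2 ≤ Real.exp (l * S T)),
          Real.exp (l * S T)
        ≤ ∑ T ∈ univ.filter (fun T : Finset E => ¬ M / 2 ≤ Real.exp (l * S T)), M / 2 :=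
          sum_le_sum fun T hT => (not_le.1 (mem_filter.1 hT).2).le
      _ ≤ ∑ T : Finset E, M / 2 :=
          sum_le_sum_of_subset_of_nonneg (filter_subset _ _) fun _ _ _ => by positivity
      _ = P * (M / 2) := by
          rw [sum_const, card_univ, Fintype.card_finset, nsmul_eq_mul]; push_cast; rfl
  have hcs : (∑ T ∈ W, Real.exp (l * S T)) ^ 2 ≤ W.card * (P * Real.exp (2 * B ^ 2)) := by
    refine sq_sum_le_card_mul_sum_sq.trans ?_
    gcongr
    calc ∑ T ∈ W, Real.exp (l * S T) ^ 2 = ∑ T ∈ W, Real.exp (2 * l * S T) :=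
          sum_congr rfl fun T _ => by rw [← Real.exp_nat_mul]; push_cast; ring_nf
      _ ≤ ∑ T : Finset E, Real.exp (2 * l * S T) :=
          sum_le_sum_of_subset_of_nonneg (subset_univ _) fun _ _ _ => (Real.exp_pos _).le
      _ = P * Real.cosh (2 * l) ^ d := hmgf _
      _ ≤ P * Real.exp ((2 * l) ^ 2 / 2) ^ d := by
          gcongr
          exact Real.cosh_le_exp_half_sq _
      _ = P * Real.exp (2 * B ^ 2) := by
          rw [← Real.exp_nat_mul, ← hld]; ring_nf
  have hlow : P / 2 ≤ ∑ T ∈ W, Real.exp (l * S T) := by nlinarith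
  have hsq : (P / 2) ^ 2 ≤ W.card * (P * Real.exp (2 * B ^ 2)) :=
    le_trans (by gcongr) hcs
  have hneg : Real.exp (-2 * B ^ 2) = (Real.exp (2 * B ^ 2))⁻¹ := by
    rw [← Real.exp_neg]; ring_nf
  rw [hneg]
  have hE : 0 < Real.exp (2 * B ^ 2) := Real.exp_pos _
  have : P * (P / 4) ≤ P * (W.card * Real.exp (2 * B ^ 2)) := by nlinarith
  have h8 := le_of_mul_le_mul_left this hPpos
  calc P * ((Real.exp (2 * B ^ 2))⁻¹ / 4) = (P / 4) / Real.exp (2 * B ^ 2) := by ring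
    _ ≤ W.card := by rw [div_le_iff₀ hE]; exact h8

lemma pow_mul_le_card_filter_forall {E V : Type} [Fintype E] [DecidableEq E] [DecidableEq V]
    (p : V → Finset E → Prop) [∀ v, DecidablePred (p v)]
    (hp : ∀ v T T', T ⊆ T' → p v T → p v T') (δ : ℝ) (hδ : 0 ≤ δ)
    (hcard : ∀ v, 2 ^ Fintype.card E * δ ≤ ((univ.filter (p v)).card : ℝ)) (s : Finset V) :
    2 ^ Fintype.card E * δ ^ s.card ≤ ((univ.filter fun T => ∀ v ∈ s, p v T).card : ℝ) := by
  induction s using Finset.induction_on with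
  | empty => simp [Fintype.card_finset]
  | insert v s hv ih =>
    have hup1 : IsUpperSet ((univ.filter (p v) : Finset (Finset E)) : Set (Finset E)) := by
      intro T T' hTT hT
      simp only [coe_filter, mem_univ, true_and, Set.mem_ofPred_eq] at hT ⊢
      exact hp v T T' hTT hT
    have hup2 : IsUpperSet
        ((univ.filter fun T => ∀ v ∈ s, p v T : Finset (Finset E)) : Set (Finset E)) := by
      intro T T' hTT hT
      simp only [coe_filter, mem_univ, true_and, Set.mem_ofPred_eq] at hT ⊢
      exact fun w hw => hp w T T' hTT (hT w hw)
    have hH := hup1.le_card_inter_finset hup2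
    rw [← filter_and] at hH
    have heq : (univ.filter fun T => ∀ w ∈ insert v s, p w T) =
        univ.filter fun T => p v T ∧ ∀ w ∈ s, p w T := by
      ext T; simp
    rw [heq, card_insert_of_notMem hv]
    have hH' : ((univ.filter (p v)).card : ℝ) * ((univ.filter fun T => ∀ v ∈ s, p v T).card : ℝ)
        ≤ 2 ^ Fintype.card E * ((univ.filter fun T => p v T ∧ ∀ w ∈ s, p w T).card : ℝ) := by
      exact_mod_cast hH
    have h2 : (0 : ℝ) < 2 ^ Fintype.card E := by positivity
    have := (mul_le_mul (hcard v) ih (by positivity) (by positivity)).trans hH'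
    refine le_of_mul_le_mul_left ?_ h2
    calc _ = 2 ^ Fintype.card E * δ * (2 ^ Fintype.card E * δ ^ s.card) := by ring
      _ ≤ _ := this

/-- The potential edges of a graph on `V`. -/
abbrev EdgeSlot (V : Type) : Type := {e : Sym2 V // ¬e.IsDiag}

/-- The graph with a prescribed set of edges. -/
def graphOf {V : Type} (T : Finset (EdgeSlot V)) : SimpleGraph V where
  Adj v w := ∃ h : ¬(s(v, w)).IsDiag, (⟨s(v, w), h⟩ : EdgeSlot V) ∈ T
  symm := ⟨fun v w ⟨h, hT⟩ => by
    have hs : s(v, w) = s(w, v) := Sym2.eq_swap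
    simp only [hs] at h hT
    exact ⟨h, hT⟩⟩
  loopless := ⟨fun v ⟨h, _⟩ => h (by simp)⟩

lemma mem_iff_graphOf_adj {V : Type} (T : Finset (EdgeSlot V)) (v w : V)
    (h : ¬(s(v, w)).IsDiag) :
    (⟨s(v, w), h⟩ : EdgeSlot V) ∈ T ↔ (graphOf T).Adj v w :=
  ⟨fun hT => ⟨h, hT⟩, fun ⟨_, hT⟩ => hT⟩

lemma graphOf_bijective {V : Type} [Fintype V] :
    Function.Bijective (graphOf : Finset (EdgeSlot V) → SimpleGraph V) := by
  classical
  constructor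
  · intro T T' hTT
    ext ⟨e, he⟩
    induction e using Sym2.ind with
    | _ v w => rw [mem_iff_graphOf_adj, mem_iff_graphOf_adj, hTT]
  · intro G
    refine ⟨univ.filter fun e => e.1 ∈ G.edgeSet, ?_⟩
    ext v w
    constructor
    · rintro ⟨h, hT⟩
      simpa using hT
    · intro h
      exact ⟨by simpa using h.ne, by simpa using h⟩

lemma natCard_graph_eq {V : Type} [Fintype V] [DecidableEq V] (P : SimpleGraph V → Prop)
    [DecidablePred fun T : Finset (EdgeSlot V) => P (graphOf T)] :
    Nat.card {G : SimpleGraph V // P G} =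
      (univ.filter fun T : Finset (EdgeSlot V) => P (graphOf T)).card := by
  rw [← Nat.card_congr ((Equiv.ofBijective _ graphOf_bijective).subtypeEquiv
    (p := fun T => P (graphOf T)) (q := P) fun T => Iff.rfl), Nat.card_eq_fintype_card,
    Fintype.card_subtype]

open Classical in
/-- The real-valued adjacency indicator. -/
noncomputable def adjInd {V : Type} (G : SimpleGraph V) (v w : V) : ℝ :=
  if G.Adj v w then 1 else 0

open Classical in
/-- The signed adjacency indicator, vanishing on the diagonal. -/
noncomputable def pairSign {V : Type} (T : Finset (EdgeSlot V)) (v w : V) : ℝ :=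
  if v = w then 0 else if (graphOf T).Adj v w then 1 else -1

lemma pairSign_eq_rademacher {V : Type} [DecidableEq V] (T : Finset (EdgeSlot V)) (v w : V)
    (h : ¬(s(v, w)).IsDiag) :
    rademacher T (⟨s(v, w), h⟩ : EdgeSlot V) = pairSign T v w := by
  classical
  have hne : v ≠ w := by simpa using h
  simp only [rademacher, pairSign, hne, if_false]
  exact if_congr (mem_iff_graphOf_adj T v w h) rfl rfl

lemma adjInd_graphOf {V : Type} [DecidableEq V] (T : Finset (EdgeSlot V)) (v w : V) :
    adjInd (graphOf T) v w = (pairSign T v w + if v = w then 0 else 1) / 2 := by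
  by_cases h : v = w
  · subst h; simp [adjInd, pairSign]
  · by_cases h2 : (graphOf T).Adj v w
    · simp [adjInd, pairSign, h, h2]
    · simp [adjInd, pairSign, h, h2]

lemma exists_le_card_rademacher_degree_ge (C : ℝ) (hC : 0 < C) :
    ∃ δ : ℝ, 0 < δ ∧ ∃ d₀ : ℕ, ∀ (V : Type) [Fintype V] [DecidableEq V],
      d₀ ≤ Fintype.card V - 1 →
      2 ^ Fintype.card (EdgeSlot V) * δ ^ Fintype.card V ≤
        ((univ.filter fun T : Finset (EdgeSlot V) => ∀ v,
          C * Real.sqrt ((Fintype.card V - 1 : ℕ) : ℝ) ≤ ∑ w, pairSign T v w).card : ℝ) := by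
  obtain ⟨δ, hδ, d₀, hd⟩ := exists_le_card_rademacher_ge C hC
  refine ⟨δ, hδ, d₀, fun V _ _ hV => ?_⟩
  have hstar : ∀ v : V, ∃ F : Finset (EdgeSlot V), F.card = Fintype.card V - 1 ∧
      ∀ T, ∑ e ∈ F, rademacher T e = ∑ w, pairSign T v w := by
    intro v
    set f : {w : V // w ≠ v} → EdgeSlot V := fun w => ⟨s(v, w.1), by simpa using w.2.symm⟩
      with hf
    have hinj : Function.Injective f := by
      intro w w' h
      have h1 : s(v, w.1) = s(v, w'.1) := congrArg Subtype.val h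
      exact Subtype.ext (Sym2.congr_right.1 h1)
    refine ⟨univ.image f, ?_, fun T => ?_⟩
    · rw [card_image_of_injective _ hinj, card_univ, Fintype.card_subtype_compl]
      simp
    · rw [sum_image fun _ _ _ _ h => hinj h]
      have : ∀ w : {w : V // w ≠ v}, rademacher T (f w) = pairSign T v w.1 :=
        fun w => pairSign_eq_rademacher T v w.1 _
      simp_rw [this]
      rw [← sum_subtype (univ.filter fun w => w ≠ v) (by simp) (fun w => pairSign T v w),
        sum_filter]
      refine sum_congr rfl fun w _ => ?_
      by_cases h : w = v
      · simp [h, pairSign]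
      · simp [h]
  choose F hF hFs using hstar
  rw [show δ ^ Fintype.card V = δ ^ (univ : Finset V).card by rw [card_univ]]
  refine (pow_mul_le_card_filter_forall (fun v (T : Finset (EdgeSlot V)) =>
    C * Real.sqrt ((Fintype.card V - 1 : ℕ) : ℝ) ≤ ∑ w, pairSign T v w) ?_ δ hδ.le ?_ univ).trans
    (Nat.cast_le.2 (card_le_card fun T hT => by simpa using hT))
  · intro v T T' hTT h
    simp only [← hFs] at h ⊢
    refine h.trans (sum_le_sum fun e _ => ?_)
    by_cases he : e ∈ T
    · simp [rademacher, he, hTT he]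
    · simp only [rademacher, he, if_false]
      split_ifs <;> norm_num
  · intro v
    have := hd (EdgeSlot V) (F v) (by rw [hF]; exact hV)
    simpa only [hFs, hF] using this

/-- Many graphs have every degree biased along a balanced sign pattern `σ`. -/
lemma exists_le_card_signed_degree_ge (C : ℝ) (hC : 0 < C) :
    ∃ δ : ℝ, 0 < δ ∧ ∃ d₀ : ℕ, ∀ (V : Type) [Fintype V] [DecidableEq V] (σ : V → ℝ),
      (∀ v, σ v = 1 ∨ σ v = -1) → ∑ v, σ v = 0 → d₀ ≤ Fintype.card V - 1 →
      2 ^ Fintype.card (EdgeSlot V) * δ ^ Fintype.card V ≤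
        (Nat.card {G : SimpleGraph V // ∀ v,
          (C * Real.sqrt ((Fintype.card V - 1 : ℕ) : ℝ) - 1) / 2 ≤
            σ v * ∑ w, σ w * adjInd G v w} : ℝ) := by
  obtain ⟨δ, hδ, d₀, hd⟩ := exists_le_card_rademacher_degree_ge C hC
  refine ⟨δ, hδ, d₀, fun V _ _ σ hσ hσ0 hV => (hd V hV).trans ?_⟩
  rw [natCard_graph_eq, Nat.cast_le]
  set X : Finset (EdgeSlot V) := univ.filter fun e => ∃ v w, e.1 = s(v, w) ∧ σ v ≠ σ w with hX
  have hXmem : ∀ v w (h : ¬(s(v, w)).IsDiag),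
      (⟨s(v, w), h⟩ : EdgeSlot V) ∈ X ↔ σ v ≠ σ w := by
    intro v w h
    simp only [hX, mem_filter, mem_univ, true_and]
    constructor
    · rintro ⟨a, b, hab, hne⟩
      rcases Sym2.eq_iff.1 hab with ⟨rfl, rfl⟩ | ⟨rfl, rfl⟩
      · exact hne
      · exact hne.symm
    · exact fun hne => ⟨v, w, rfl, hne⟩
  have hsign : ∀ T v w, pairSign (symmDiff T X) v w = σ v * σ w * pairSign T v w := by
    intro T v w
    by_cases hvw : v = w
    · simp [pairSign, hvw]
    have h : ¬(s(v, w)).IsDiag := by simpa using hvw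
    rw [← pairSign_eq_rademacher _ _ _ h, ← pairSign_eq_rademacher _ _ _ h]
    simp only [rademacher, mem_symmDiff, hXmem]
    by_cases hT : (⟨s(v, w), h⟩ : EdgeSlot V) ∈ T <;>
      rcases hσ v with h1 | h1 <;> rcases hσ w with h2 | h2 <;>
      norm_num [hT, h1, h2]
  refine card_le_card_of_injOn (fun T => symmDiff T X) (fun T hT => ?_)
    fun T _ T' _ h => symmDiff_left_injective X h
  have hT' := (mem_filter.1 (mem_coe.1 hT)).2
  refine mem_coe.2 (mem_filter.2 ⟨mem_univ _, fun v => ?_⟩)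
  have h1 := hT' v
  have hsq : ∀ v, σ v * σ v = 1 := fun v => by rcases hσ v with h | h <;> simp [h]
  have h2 : σ v * ∑ w, σ w * adjInd (graphOf (symmDiff T X)) v w =
      ∑ w, (pairSign T v w + σ v * σ w - if v = w then 1 else 0) / 2 := by
    rw [mul_sum]
    refine sum_congr rfl fun w _ => ?_
    rw [adjInd_graphOf, hsign]
    have e1 := hsq v
    have e2 := hsq w
    by_cases hvw : v = w
    · subst hvw; simp [pairSign, e1]
    · simp only [hvw, if_false]
      linear_combination (pairSign T v w * σ w * σ w / 2) * e1 + (pairSign T v w / 2) * e2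
  rw [h2, ← sum_div, sum_sub_distrib, sum_add_distrib, ← mul_sum, hσ0]
  simp only [mul_zero, add_zero, sum_ite_eq, mem_univ, if_true]
  linarith

/-- The sign attached to a side of a bipartition. -/
def sideSign (b : Bool) : ℝ := if b then 1 else -1

section FiberSums

variable {E V : Type} [Fintype E] [DecidableEq E] [DecidableEq V]

/-- The Rademacher sum over the fiber of `π` above `v`. -/
noncomputable def fiberSum (π : E → V) (T : Finset E) (v : V) : ℝ :=
  ∑ e with π e = v, rademacher T e

lemma card_lt_sum_sq_fiberSum_le [Fintype V] (π : E → V) (n : ℕ) (hn : 0 < n)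
    (hπ : ∀ v, (univ.filter fun e => π e = v).card ≤ n) (K : ℝ) :
    ((univ.filter fun T : Finset E => K < ∑ v, (fiberSum π T v / Real.sqrt n) ^ 2).card : ℝ) ≤
      2 ^ Fintype.card E * (Real.exp (-K / 4) * latticeConst ^ Fintype.card V) := by
  have hn' : (0 : ℝ) < n := by exact_mod_cast hn
  have hs : Real.sqrt n ^ 2 = n := Real.sq_sqrt hn'.le
  have h := card_lt_sum_sq_rademacher_le
    (fun (v : V) (e : E) => if π e = v then (1 : ℝ) / Real.sqrt n else 0) (fun t => ?_) K
  · convert h using 7 with T v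
    rw [fiberSum, sum_filter, sum_div]
    refine sum_congr rfl fun e _ => ?_
    split_ifs <;> ring
  · simp_rw [mul_ite, mul_zero, sum_ite_eq, mem_univ, if_true, mul_pow, div_pow, hs]
    rw [← sum_fiberwise (s := univ) (g := π)]
    refine sum_le_sum fun v _ => ?_
    have h1 : ∀ e ∈ univ.filter (fun e => π e = v),
        t (π e) ^ 2 * (1 ^ 2 / (n : ℝ)) = t v ^ 2 / n := by
      intro e he
      rw [(mem_filter.1 he).2]; ring
    rw [sum_congr rfl h1, sum_const, nsmul_eq_mul, mul_div_assoc', div_le_iff₀ hn', mul_comm]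
    gcongr
    exact hπ v

/-- The fiber sums, rounded at scale `√n`. -/
noncomputable def fiberBucket (π : E → V) (n : ℕ) (T : Finset E) (v : V) : ℤ :=
  ⌊fiberSum π T v / Real.sqrt n⌋

lemma abs_fiberSum_sub_le (π : E → V) (n : ℕ) (hn : 0 < n) (T T' : Finset E)
    (h : fiberBucket π n T = fiberBucket π n T') (v : V) :
    |fiberSum π T v - fiberSum π T' v| ≤ Real.sqrt n := by
  have hs : 0 < Real.sqrt n := Real.sqrt_pos.2 (by exact_mod_cast hn)
  have h1 := (Int.abs_sub_lt_one_of_floor_eq_floor (congrFun h v)).le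
  rwa [← sub_div, abs_div, abs_of_pos hs, div_le_one hs] at h1

lemma card_image_fiberBucket_le [Fintype V] (π : E → V) (n : ℕ) (hV : Fintype.card V ≤ n) (K : ℝ)
    (s : Finset (Finset E))
    (hs : ∀ T ∈ s, ∑ v, (fiberSum π T v / Real.sqrt n) ^ 2 ≤ K * n) :
    ((s.image (fiberBucket π n)).card : ℝ) ≤
      Real.exp ((2 * K + 2) * n / 8) * latticeConst ^ n := by
  refine (card_lattice_ball_le _ ((2 * K + 2) * n) fun k hk => ?_).trans ?_
  · obtain ⟨T, hT, rfl⟩ := mem_image.1 hk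
    have hV' : (Fintype.card V : ℝ) ≤ n := by exact_mod_cast hV
    calc ∑ v, (fiberBucket π n T v : ℝ) ^ 2
        ≤ ∑ v, (2 * (fiberSum π T v / Real.sqrt n) ^ 2 + 2) := by
          refine sum_le_sum fun v _ => ?_
          have h1 := Int.floor_le (fiberSum π T v / Real.sqrt n)
          have h2 := Int.lt_floor_add_one (fiberSum π T v / Real.sqrt n)
          unfold fiberBucket
          nlinarith [sq_nonneg (2 * (fiberSum π T v / Real.sqrt n) -
            ⌊fiberSum π T v / Real.sqrt n⌋)]
      _ = 2 * ∑ v, (fiberSum π T v / Real.sqrt n) ^ 2 + 2 * Fintype.card V := by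
          rw [sum_add_distrib, ← mul_sum, sum_const, card_univ, nsmul_eq_mul]; ring
      _ ≤ _ := by linarith [hs T hT]
  · gcongr
    exact one_le_latticeConst

end FiberSums

/-- Four blocks `Fin p × Fin q` assembled into one bipartite graph. -/
def assembleBlocks {p q : ℕ} (x : Bool → Bool → Finset (Fin p × Fin q)) :
    Finset ((Bool × Fin p) × (Bool × Fin q)) :=
  univ.filter fun e => (e.1.2, e.2.2) ∈ x e.1.1 e.2.1

lemma assembleBlocks_injective {p q : ℕ} :
    Function.Injective (assembleBlocks : (Bool → Bool → Finset (Fin p × Fin q)) → _) := by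
  intro x y h
  funext a b
  ext ⟨i, j⟩
  have := congrArg (fun M => ((a, i), (b, j)) ∈ M) h
  simpa [assembleBlocks] using this

/-- The bipartite graphs in which every vertex splits its neighbours nearly evenly between the
two sides of the opposite class. -/
noncomputable def balancedBipartite (p q n : ℕ) :
    Finset (Finset ((Bool × Fin p) × (Bool × Fin q))) :=
  univ.filter fun M =>
    (∀ a, |∑ b : Bool × Fin q, sideSign b.1 * if (a, b) ∈ M then 1 else 0| ≤ Real.sqrt n) ∧
    ∀ b, |∑ a : Bool × Fin p, sideSign a.1 * if (a, b) ∈ M then 1 else 0| ≤ Real.sqrt n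

lemma fiberSum_fst {p q : ℕ} (T : Finset (Fin p × Fin q)) (i : Fin p) :
    fiberSum Prod.fst T i = 2 * (∑ j : Fin q, if (i, j) ∈ T then (1 : ℝ) else 0) - q := by
  have h : fiberSum Prod.fst T i = ∑ j : Fin q, rademacher T (i, j) := by
    rw [fiberSum, sum_filter, Fintype.sum_prod_type, Fintype.sum_eq_single i]
    · simp
    · intro i' hi; simp [hi]
  have h2 : (q : ℝ) = ∑ _j : Fin q, (1 : ℝ) := by simp
  rw [h, h2, mul_sum, ← sum_sub_distrib]
  refine sum_congr rfl fun j _ => ?_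
  unfold rademacher
  split_ifs <;> norm_num

lemma fiberSum_snd {p q : ℕ} (T : Finset (Fin p × Fin q)) (j : Fin q) :
    fiberSum Prod.snd T j = 2 * (∑ i : Fin p, if (i, j) ∈ T then (1 : ℝ) else 0) - p := by
  have h : fiberSum Prod.snd T j = ∑ i : Fin p, rademacher T (i, j) := by
    rw [fiberSum, sum_filter, Fintype.sum_prod_type_right, Fintype.sum_eq_single j]
    · simp
    · intro i' hi; simp [hi]
  have h2 : (p : ℝ) = ∑ _i : Fin p, (1 : ℝ) := by simp
  rw [h, h2, mul_sum, ← sum_sub_distrib]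
  refine sum_congr rfl fun i _ => ?_
  unfold rademacher
  split_ifs <;> norm_num

lemma assembleBlocks_mem_balancedBipartite {p q n : ℕ} (hn : 0 < n)
    (x : Bool → Bool → Finset (Fin p × Fin q))
    (hrow : ∀ a, fiberBucket Prod.fst n (x a true) = fiberBucket Prod.fst n (x a false))
    (hcol : ∀ b, fiberBucket Prod.snd n (x true b) = fiberBucket Prod.snd n (x false b)) :
    assembleBlocks x ∈ balancedBipartite p q n := by
  have hs : 0 ≤ Real.sqrt n := Real.sqrt_nonneg _
  refine mem_filter.2 ⟨mem_univ _, ?_, ?_⟩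
  · rintro ⟨a, i⟩
    have h := abs_fiberSum_sub_le Prod.fst n hn _ _ (hrow a) i
    rw [fiberSum_fst, fiberSum_fst] at h
    rw [Fintype.sum_prod_type, Fintype.sum_bool]
    simp only [← mul_sum, assembleBlocks, mem_filter, mem_univ, true_and, sideSign, if_true,
      Bool.false_eq_true, if_false]
    rw [abs_le] at h ⊢
    constructor <;> linarith [h.1, h.2]
  · rintro ⟨b, j⟩
    have h := abs_fiberSum_sub_le Prod.snd n hn _ _ (hcol b) j
    rw [fiberSum_snd, fiberSum_snd] at h
    rw [Fintype.sum_prod_type, Fintype.sum_bool]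
    simp only [← mul_sum, assembleBlocks, mem_filter, mem_univ, true_and, sideSign, if_true,
      Bool.false_eq_true, if_false]
    rw [abs_le] at h ⊢
    constructor <;> linarith [h.1, h.2]

/-- An exponentially small proportion of all bipartite graphs is balanced. -/
lemma exists_exp_mul_le_card_balancedBipartite :
    ∃ κ : ℝ, 0 < κ ∧ ∀ p q n : ℕ, 0 < n → p ≤ n → q ≤ n →
      Real.exp (-κ * n) * (2 ^ (p * q)) ^ 4 ≤ ((balancedBipartite p q n).card : ℝ) := by
  set L := Real.log latticeConst with hL
  have hLpos : 0 ≤ L := Real.log_nonneg one_le_latticeConst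
  have hexpL : ∀ n : ℕ, latticeConst ^ n = Real.exp (L * n) := by
    intro n
    rw [mul_comm, Real.exp_nat_mul, hL,
      Real.exp_log (lt_of_lt_of_le one_pos one_le_latticeConst)]
  set K := 4 * (L + 2) with hK
  refine ⟨K + 4 * L + 5, by positivity, fun p q n hn hp hq => ?_⟩
  have hn1 : (1 : ℝ) ≤ n := by exact_mod_cast hn
  have he1 : (2 : ℝ) ≤ Real.exp 1 := by linarith [Real.add_one_le_exp 1]
  have he4 : (16 : ℝ) ≤ Real.exp (4 * n) := by
    calc (16 : ℝ) = 2 ^ 4 := by norm_num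
      _ ≤ Real.exp 1 ^ 4 := by gcongr
      _ = Real.exp 4 := by rw [← Real.exp_nat_mul]; norm_num
      _ ≤ _ := Real.exp_le_exp.2 (by linarith)
  have hsmall : Real.exp (-(K * n) / 4) * latticeConst ^ n ≤ 1 / 4 := by
    rw [hexpL, ← Real.exp_add]
    calc Real.exp (-(K * n) / 4 + L * n) ≤ Real.exp (-2) :=
          Real.exp_le_exp.2 (by rw [hK]; nlinarith)
      _ = (Real.exp 1 ^ 2)⁻¹ := by rw [← Real.exp_nat_mul, ← Real.exp_neg]; norm_num
      _ ≤ (2 ^ 2)⁻¹ := by gcongr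
      _ = 1 / 4 := by norm_num
  have hfst : ∀ i : Fin p, (univ.filter fun e : Fin p × Fin q => e.1 = i).card ≤ n := by
    intro i
    refine le_trans (card_le_card_of_injOn (t := (univ : Finset (Fin q))) Prod.snd
      (fun _ _ => mem_coe.2 (mem_univ _)) ?_) (by simpa using hq)
    intro e he e' he' h
    exact Prod.ext ((mem_filter.1 he).2.trans (mem_filter.1 he').2.symm) h
  have hsnd : ∀ j : Fin q, (univ.filter fun e : Fin p × Fin q => e.2 = j).card ≤ n := by
    intro j
    refine le_trans (card_le_card_of_injOn (t := (univ : Finset (Fin p))) Prod.fst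
      (fun _ _ => mem_coe.2 (mem_univ _)) ?_) (by simpa using hp)
    intro e he e' he' h
    exact Prod.ext h ((mem_filter.1 he).2.trans (mem_filter.1 he').2.symm)
  set N : ℝ := 2 ^ (p * q) with hN
  have hNpos : 0 < N := by positivity
  have hcardE : (2 : ℝ) ^ Fintype.card (Fin p × Fin q) = N := by simp [hN]
  set Q1 := fun T : Finset (Fin p × Fin q) =>
    ∑ v, (fiberSum Prod.fst T v / Real.sqrt n) ^ 2 with hQ1
  set Q2 := fun T : Finset (Fin p × Fin q) =>
    ∑ v, (fiberSum Prod.snd T v / Real.sqrt n) ^ 2 with hQ2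
  have hb1 : ((univ.filter fun T => K * n < Q1 T).card : ℝ) ≤ N / 4 := by
    have h := card_lt_sum_sq_fiberSum_le (Prod.fst : Fin p × Fin q → Fin p) n hn hfst (K * n)
    rw [hcardE, Fintype.card_fin] at h
    refine h.trans ?_
    have : latticeConst ^ p ≤ latticeConst ^ n := pow_le_pow_right₀ one_le_latticeConst hp
    calc N * (Real.exp (-(K * n) / 4) * latticeConst ^ p)
        ≤ N * (Real.exp (-(K * n) / 4) * latticeConst ^ n) := by gcongr
      _ ≤ N * (1 / 4) := by gcongr
      _ = N / 4 := by ring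
  have hb2 : ((univ.filter fun T => K * n < Q2 T).card : ℝ) ≤ N / 4 := by
    have h := card_lt_sum_sq_fiberSum_le (Prod.snd : Fin p × Fin q → Fin q) n hn hsnd (K * n)
    rw [hcardE, Fintype.card_fin] at h
    refine h.trans ?_
    have : latticeConst ^ q ≤ latticeConst ^ n := pow_le_pow_right₀ one_le_latticeConst hq
    calc N * (Real.exp (-(K * n) / 4) * latticeConst ^ q)
        ≤ N * (Real.exp (-(K * n) / 4) * latticeConst ^ n) := by gcongr
      _ ≤ N * (1 / 4) := by gcongr
      _ = N / 4 := by ring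
  set s := univ.filter fun T => Q1 T ≤ K * n ∧ Q2 T ≤ K * n with hs
  have hscard : N / 2 ≤ s.card := by
    have hcover : (univ : Finset (Finset (Fin p × Fin q))) ⊆
        s ∪ ((univ.filter fun T => K * n < Q1 T) ∪ univ.filter fun T => K * n < Q2 T) := by
      intro T _
      simp only [hs, mem_union, mem_filter, mem_univ, true_and]
      by_cases h1 : K * n < Q1 T
      · exact Or.inr (Or.inl h1)
      by_cases h2 : K * n < Q2 T
      · exact Or.inr (Or.inr h2)
      exact Or.inl ⟨not_lt.1 h1, not_lt.1 h2⟩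
    have h1 := (card_le_card hcover).trans ((card_union_le _ _).trans
      (Nat.add_le_add_left (card_union_le _ _) _))
    rw [card_univ, Fintype.card_finset] at h1
    have h2 : N ≤ s.card + (((univ.filter fun T => K * n < Q1 T).card : ℝ) +
        ((univ.filter fun T => K * n < Q2 T).card : ℝ)) := by
      rw [← hcardE]; exact_mod_cast h1
    linarith
  have hi1 := card_image_fiberBucket_le (Prod.fst : Fin p × Fin q → Fin p) n (by simpa using hp)
    K s fun T hT => (mem_filter.1 hT).2.1
  have hi2 := card_image_fiberBucket_le (Prod.snd : Fin p × Fin q → Fin q) n (by simpa using hq)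
    K s fun T hT => (mem_filter.1 hT).2.2
  have hc4 := pow_four_card_le_four_cycles s (fiberBucket Prod.fst n) (fiberBucket Prod.snd n)
  set Z := ((s ×ˢ s) ×ˢ (s ×ˢ s)).filter fun x =>
    fiberBucket Prod.snd n x.1.1 = fiberBucket Prod.snd n x.1.2 ∧
    fiberBucket Prod.snd n x.2.1 = fiberBucket Prod.snd n x.2.2 ∧
    fiberBucket Prod.fst n x.1.1 = fiberBucket Prod.fst n x.2.1 ∧
    fiberBucket Prod.fst n x.1.2 = fiberBucket Prod.fst n x.2.2 with hZ
  have hZle : Z.card ≤ (balancedBipartite p q n).card := by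
    refine card_le_card_of_injOn (fun x => assembleBlocks fun a b =>
      if a then (if b then x.1.1 else x.2.1) else (if b then x.1.2 else x.2.2))
      (fun x hx => ?_) fun x _ y _ h => ?_
    · obtain ⟨h1, h2, h3, h4⟩ := (mem_filter.1 (mem_coe.1 hx)).2
      refine mem_coe.2 (assembleBlocks_mem_balancedBipartite hn _ ?_ ?_)
      · rintro (_ | _) <;> simp [h3, h4]
      · rintro (_ | _) <;> simp [h1, h2]
    · have h' := assembleBlocks_injective h
      have e := fun a b => congrFun (congrFun h' a) b
      have e1 := e true true
      have e2 := e true false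
      have e3 := e false true
      have e4 := e false false
      simp only [if_true, Bool.false_eq_true, if_false] at e1 e2 e3 e4
      exact Prod.ext (Prod.ext e1 e3) (Prod.ext e2 e4)
  have hc4' : (s.card : ℝ) ^ 4 ≤ ((s.image (fiberBucket Prod.fst n)).card : ℝ) ^ 2 *
      ((s.image (fiberBucket Prod.snd n)).card : ℝ) ^ 2 * Z.card := by exact_mod_cast hc4
  set I := Real.exp ((2 * K + 2) * n / 8) * latticeConst ^ n with hI
  have hIeq : I ^ 4 = Real.exp ((K + 1 + 4 * L) * n) := by
    rw [hI, hexpL, ← Real.exp_add, ← Real.exp_nat_mul]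
    congr 1; push_cast; ring
  have hfinal : (N / 2) ^ 4 ≤ I ^ 4 * (balancedBipartite p q n).card := by
    calc (N / 2) ^ 4 ≤ (s.card : ℝ) ^ 4 := by gcongr
      _ ≤ _ := hc4'
      _ ≤ I ^ 2 * I ^ 2 * (balancedBipartite p q n).card := by gcongr
      _ = _ := by ring
  have hsplit : Real.exp (-(K + 4 * L + 5) * n) =
      (Real.exp ((K + 1 + 4 * L) * n))⁻¹ * (Real.exp (4 * n))⁻¹ := by
    rw [← Real.exp_neg, ← Real.exp_neg, ← Real.exp_add]; ring_nf
  rw [hsplit, ← hIeq, mul_assoc]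
  have hIpos : 0 < I ^ 4 := by rw [hIeq]; exact Real.exp_pos _
  rw [inv_mul_le_iff₀ hIpos]
  refine le_trans ?_ hfinal
  calc (Real.exp (4 * n))⁻¹ * N ^ 4 ≤ 16⁻¹ * N ^ 4 := by gcongr
    _ = _ := by ring

lemma sum_sq_star_le {V : Type} [Fintype V] [DecidableEq V] (S : Finset V) (t : V → ℝ) :
    ∑ e : EdgeSlot V, (∑ v, t v * ∑ w ∈ S, if e.1 = s(v, w) then (1 : ℝ) else 0) ^ 2 ≤
      2 * Fintype.card V * ∑ v, t v ^ 2 := by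
  set F : EdgeSlot V → Finset (V × V) := fun e => univ.filter fun x => e.1 = s(x.1, x.2) with hF
  have hFcard : ∀ e, (F e).card ≤ 2 := by
    rintro ⟨e, he⟩
    induction e using Sym2.ind with
    | _ a b =>
      refine (card_le_card (t := {(a, b), (b, a)}) fun x hx => ?_).trans card_le_two
      have hx' : s(a, b) = s(x.1, x.2) := (mem_filter.1 hx).2
      rcases Sym2.eq_iff.1 hx' with ⟨h1, h2⟩ | ⟨h1, h2⟩
      · simp [Prod.ext_iff, h1, h2]
      · simp [Prod.ext_iff, h1, h2]
  have hpt : ∀ e : EdgeSlot V,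
      (∑ v, t v * ∑ w ∈ S, if e.1 = s(v, w) then (1 : ℝ) else 0) ^ 2 ≤
        2 * ∑ x : V × V, if e.1 = s(x.1, x.2) then t x.1 ^ 2 else 0 := by
    intro e
    have h1 : (∑ v, t v * ∑ w ∈ S, if e.1 = s(v, w) then (1 : ℝ) else 0) =
        ∑ x ∈ F e, t x.1 * if x.2 ∈ S then 1 else 0 := by
      rw [hF, sum_filter, Fintype.sum_prod_type]
      refine sum_congr rfl fun v _ => ?_
      rw [mul_sum, ← sum_filter_add_sum_filter_not univ (fun w => w ∈ S)]
      simp only [filter_mem_eq_inter, univ_inter]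
      rw [sum_eq_zero (s := univ.filter fun w => w ∉ S), add_zero]
      · refine sum_congr rfl fun w hw => ?_
        simp [hw]
      · intro w hw
        simp [(mem_filter.1 hw).2]
    rw [h1, ← sum_filter]
    refine sq_sum_le_card_mul_sum_sq.trans ?_
    have h2 : ((F e).card : ℝ) ≤ 2 := by exact_mod_cast hFcard e
    refine mul_le_mul h2 (sum_le_sum fun x _ => ?_) (sum_nonneg fun _ _ => sq_nonneg _)
      zero_le_two
    split_ifs <;> simp [sq_nonneg]
  have hcount : ∀ x : V × V, (∑ e : EdgeSlot V,
      if e.1 = s(x.1, x.2) then t x.1 ^ 2 else 0) ≤ t x.1 ^ 2 := by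
    intro x
    rw [← sum_filter, sum_const, nsmul_eq_mul]
    have : (univ.filter fun e : EdgeSlot V => e.1 = s(x.1, x.2)).card ≤ 1 :=
      card_le_one.2 fun e he e' he' =>
        Subtype.ext ((mem_filter.1 he).2.trans (mem_filter.1 he').2.symm)
    exact mul_le_of_le_one_left (sq_nonneg _) (by exact_mod_cast this)
  calc _ ≤ ∑ e : EdgeSlot V, 2 * ∑ x : V × V, (if e.1 = s(x.1, x.2) then t x.1 ^ 2 else 0) :=
        sum_le_sum fun e _ => hpt e
    _ = 2 * ∑ x : V × V, ∑ e : EdgeSlot V, (if e.1 = s(x.1, x.2) then t x.1 ^ 2 else 0) := by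
        rw [← mul_sum, sum_comm]
    _ ≤ 2 * ∑ x : V × V, t x.1 ^ 2 := by
        gcongr with x
        exact hcount x
    _ = _ := by
        rw [Fintype.sum_prod_type]
        simp only [sum_const, card_univ, nsmul_eq_mul]
        rw [← mul_sum]; ring

lemma sum_star_rademacher {V : Type} [Fintype V] [DecidableEq V] (S : Finset V) (v : V)
    (T : Finset (EdgeSlot V)) :
    ∑ e : EdgeSlot V, (∑ w ∈ S, if e.1 = s(v, w) then (1 : ℝ) else 0) * rademacher T e =
      ∑ w ∈ S, pairSign T v w := by
  simp_rw [sum_mul]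
  rw [sum_comm]
  refine sum_congr rfl fun w _ => ?_
  by_cases hvw : v = w
  · subst hvw
    rw [sum_eq_zero]
    · simp [pairSign]
    · intro e _
      rw [if_neg, zero_mul]
      intro h
      exact e.2 (by simp [h])
  · have h : ¬(s(v, w)).IsDiag := by simpa using hvw
    rw [Fintype.sum_eq_single (⟨s(v, w), h⟩ : EdgeSlot V)]
    · simp [pairSign_eq_rademacher]
    · intro e he
      rw [if_neg, zero_mul]
      exact fun h' => he (Subtype.ext h')

lemma card_lt_sum_sq_pairSign_le {V : Type} [Fintype V] [DecidableEq V] [Nonempty V]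
    (S : Finset V) (K : ℝ) :
    ((univ.filter fun T : Finset (EdgeSlot V) =>
      2 * Fintype.card V * K < ∑ v, (∑ w ∈ S, pairSign T v w) ^ 2).card : ℝ) ≤
      2 ^ Fintype.card (EdgeSlot V) *
        (Real.exp (-K / 4) * latticeConst ^ Fintype.card V) := by
  have hN : (0 : ℝ) < 2 * Fintype.card V := by
    have : 0 < Fintype.card V := Fintype.card_pos
    positivity
  set r := Real.sqrt (2 * Fintype.card V) with hr
  have hr2 : r ^ 2 = 2 * Fintype.card V := Real.sq_sqrt hN.le
  have h := card_lt_sum_sq_rademacher_le (fun (v : V) (e : EdgeSlot V) =>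
    (∑ w ∈ S, if e.1 = s(v, w) then (1 : ℝ) else 0) / r) (fun t => ?_) K
  · refine le_trans (Nat.cast_le.2 (card_le_card fun T hT => ?_)) h
    refine mem_filter.2 ⟨mem_univ _, ?_⟩
    have hT' := (mem_filter.1 hT).2
    simp_rw [div_mul_eq_mul_div, ← sum_div, sum_star_rademacher, div_pow, hr2]
    rw [← sum_div, lt_div_iff₀ hN]
    linarith
  · simp_rw [mul_div_assoc', ← sum_div, div_pow, hr2]
    rw [← sum_div, div_le_iff₀ hN]
    linarith [sum_sq_star_le S t]

lemma degIn_eq_sum_adjInd {n : ℕ} (G : SimpleGraph (Fin n)) (v : Fin n) (S : Finset (Fin n)) :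
    (degIn G v S : ℝ) = ∑ w ∈ S, adjInd G v w := by
  classical
  have h : degIn G v S = (S.filter fun w => G.Adj v w).card := by
    rw [degIn, Nat.card_eq_fintype_card, Fintype.card_subtype]
    congr 1
    ext w; simp
  rw [h, card_eq_sum_ones, sum_filter]
  push_cast
  refine sum_congr rfl fun w _ => ?_
  unfold adjInd
  split_ifs <;> rfl

lemma graphProb_eq {n : ℕ} (P : SimpleGraph (Fin n) → Prop)
    [DecidablePred fun T : Finset (EdgeSlot (Fin n)) => P (graphOf T)] :
    graphProb n P = ((univ.filter fun T : Finset (EdgeSlot (Fin n)) => P (graphOf T)).card : ℝ) /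
      2 ^ Fintype.card (EdgeSlot (Fin n)) := by
  rw [graphProb, natCard_graph_eq, Sym2.card_subtype_not_diag, Fintype.card_fin]

/-- Large total squared degree deviation is exponentially unlikely, at any prescribed rate. -/
lemma exists_graphProb_degree_variance_le (κ : ℝ) :
    ∃ K : ℝ, 0 < K ∧ ∀ n : ℕ, 0 < n →
      graphProb (2 * n) (fun G => ¬∀ S : Finset (Fin (2 * n)),
        ∑ v : Fin (2 * n), ((degIn G v S : ℝ) - (S.card : ℝ) / 2) ^ 2 ≤ K * (n : ℝ) ^ 2) ≤
        Real.exp (-κ * n) := by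
  classical
  set L := Real.log latticeConst with hL
  have hLpos : 0 ≤ L := Real.log_nonneg one_le_latticeConst
  have hexpL : ∀ n : ℕ, latticeConst ^ n = Real.exp (L * n) := by
    intro n
    rw [mul_comm, Real.exp_nat_mul, hL,
      Real.exp_log (lt_of_lt_of_le one_pos one_le_latticeConst)]
  refine ⟨16 * (|κ| + 2 * L + 2), by positivity, fun n hn => ?_⟩
  set K := 16 * (|κ| + 2 * L + 2) with hK
  have hn1 : (1 : ℝ) ≤ n := by exact_mod_cast hn
  have hK2 : 2 ≤ K := by rw [hK]; linarith [abs_nonneg κ]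
  have : Nonempty (Fin (2 * n)) := ⟨⟨0, by omega⟩⟩
  set N : ℝ := 2 ^ Fintype.card (EdgeSlot (Fin (2 * n))) with hN
  have hNpos : 0 < N := by positivity
  rw [graphProb_eq, div_le_iff₀ hNpos]
  set bad : Finset (Fin (2 * n)) → Finset (Finset (EdgeSlot (Fin (2 * n)))) := fun S =>
    univ.filter fun T => 2 * Fintype.card (Fin (2 * n)) * (K * n / 4) <
      ∑ v, (∑ w ∈ S, pairSign T v w) ^ 2 with hbad
  have hcover : (univ.filter fun T : Finset (EdgeSlot (Fin (2 * n))) =>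
      ¬∀ S : Finset (Fin (2 * n)), ∑ v : Fin (2 * n),
        ((degIn (graphOf T) v S : ℝ) - (S.card : ℝ) / 2) ^ 2 ≤ K * (n : ℝ) ^ 2) ⊆
      univ.biUnion bad := by
    intro T hT
    have hT' := (mem_filter.1 hT).2
    push Not at hT'
    obtain ⟨S, hS⟩ := hT'
    refine mem_biUnion.2 ⟨S, mem_univ _, mem_filter.2 ⟨mem_univ _, ?_⟩⟩
    have hterm : ∀ v, ((degIn (graphOf T) v S : ℝ) - (S.card : ℝ) / 2) ^ 2 ≤
        (∑ w ∈ S, pairSign T v w) ^ 2 / 2 + 1 / 2 := by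
      intro v
      have h1 : (degIn (graphOf T) v S : ℝ) - (S.card : ℝ) / 2 =
          ((∑ w ∈ S, pairSign T v w) - if v ∈ S then 1 else 0) / 2 := by
        rw [degIn_eq_sum_adjInd, card_eq_sum_ones]
        push_cast
        simp_rw [adjInd_graphOf]
        rw [← sum_div, ← sub_div]
        congr 1
        rw [← sum_sub_distrib]
        have : (if v ∈ S then (1 : ℝ) else 0) = ∑ w ∈ S, if v = w then 1 else 0 := by
          rw [sum_ite_eq]
        rw [this, ← sum_sub_distrib]
        refine sum_congr rfl fun w _ => ?_
        split_ifs <;> ring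
      rw [h1]
      split_ifs
      · nlinarith [sq_nonneg ((∑ w ∈ S, pairSign T v w) + 1)]
      · nlinarith [sq_nonneg (∑ w ∈ S, pairSign T v w)]
    have hsum := sum_le_sum fun v (_ : v ∈ univ) => hterm v
    rw [sum_add_distrib, ← sum_div, sum_const, card_univ, nsmul_eq_mul] at hsum
    rw [Fintype.card_fin] at hsum ⊢
    push_cast at hsum ⊢
    nlinarith
  have hLn := hexpL (2 * n)
  push_cast at hLn
  have hone : ∀ S, ((bad S).card : ℝ) ≤
      N * (Real.exp (-(K * n / 4) / 4) * latticeConst ^ (2 * n)) := by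
    intro S
    refine (card_lt_sum_sq_pairSign_le S (K * n / 4)).trans (le_of_eq ?_)
    rw [Fintype.card_fin]
  have h2 : (2 : ℝ) ^ (2 * n) ≤ Real.exp (2 * n) := by
    have : (2 : ℝ) ≤ Real.exp 1 := by linarith [Real.add_one_le_exp 1]
    calc (2 : ℝ) ^ (2 * n) ≤ Real.exp 1 ^ (2 * n) := by gcongr
      _ = _ := by rw [← Real.exp_nat_mul]; push_cast; ring_nf
  calc ((univ.filter fun T : Finset (EdgeSlot (Fin (2 * n))) =>
      ¬∀ S : Finset (Fin (2 * n)), ∑ v : Fin (2 * n),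
        ((degIn (graphOf T) v S : ℝ) - (S.card : ℝ) / 2) ^ 2 ≤ K * (n : ℝ) ^ 2).card : ℝ)
      ≤ ((univ.biUnion bad).card : ℝ) := by exact_mod_cast card_le_card hcover
    _ ≤ ∑ S, ((bad S).card : ℝ) := by exact_mod_cast card_biUnion_le
    _ ≤ ∑ _S : Finset (Fin (2 * n)),
          N * (Real.exp (-(K * n / 4) / 4) * latticeConst ^ (2 * n)) :=
        sum_le_sum fun S _ => hone S
    _ = 2 ^ (2 * n) * (N * (Real.exp (-(K * n / 4) / 4) * latticeConst ^ (2 * n))) := by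
        rw [sum_const, card_univ, Fintype.card_finset, Fintype.card_fin, nsmul_eq_mul]
        push_cast; rfl
    _ ≤ Real.exp (2 * n) * (N * (Real.exp (-(K * n / 4) / 4) * Real.exp (L * (2 * n)))) := by
        rw [hLn]; gcongr
    _ = Real.exp (2 * n + (-(K * n / 4) / 4 + L * (2 * n))) * N := by
        rw [Real.exp_add, Real.exp_add]; ring
    _ ≤ Real.exp (-κ * n) * N := by
        gcongr
        rw [hK]
        nlinarith [le_abs_self κ]

lemma friendlyPair_of_le_signed_degree {m : ℕ} (G : SimpleGraph (Fin m)) (A : Finset (Fin m))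
    (t : ℝ) (h : ∀ v, t ≤ (if v ∈ A then 1 else -1) *
      ∑ w, (if w ∈ A then 1 else -1) * adjInd G v w) : FriendlyPair G A t := by
  have hsum : ∀ v, ∑ w, (if w ∈ A then (1 : ℝ) else -1) * adjInd G v w =
      degIn G v A - degIn G v Aᶜ := by
    intro v
    rw [degIn_eq_sum_adjInd, degIn_eq_sum_adjInd, ← sum_add_sum_compl A, sub_eq_add_neg,
      ← sum_neg_distrib]
    congr 1
    · exact sum_congr rfl fun w hw => by rw [if_pos hw, one_mul]
    · exact sum_congr rfl fun w hw => by rw [if_neg (mem_compl.1 hw), neg_one_mul]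
  refine ⟨fun v hv => ?_, fun v hv => ?_⟩
  · have := h v
    rw [hsum, if_pos hv] at this
    linarith
  · have := h v
    rw [hsum, if_neg (mem_compl.1 hv)] at this
    linarith

/-- The graph on a disjoint union with prescribed parts and prescribed cross edges. -/
def joinGraph {U W : Type} (H₁ : SimpleGraph U) (H₂ : SimpleGraph W) (M : Finset (U × W)) :
    SimpleGraph (U ⊕ W) where
  Adj
    | .inl a, .inl b => H₁.Adj a b
    | .inr a, .inr b => H₂.Adj a b
    | .inl a, .inr b => (a, b) ∈ M
    | .inr b, .inl a => (a, b) ∈ M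
  symm := ⟨by
    rintro (a | a) (b | b) h
    · exact SimpleGraph.Adj.symm h
    · exact h
    · exact h
    · exact SimpleGraph.Adj.symm h⟩
  loopless := ⟨by
    rintro (a | a) h
    · exact H₁.loopless.irrefl a h
    · exact H₂.loopless.irrefl a h⟩

lemma joinGraph_injective {U W : Type} : Function.Injective
    fun x : SimpleGraph U × SimpleGraph W × Finset (U × W) => joinGraph x.1 x.2.1 x.2.2 := by
  rintro ⟨H₁, H₂, M⟩ ⟨H₁', H₂', M'⟩ h
  have hadj : ∀ x y, (joinGraph H₁ H₂ M).Adj x y ↔ (joinGraph H₁' H₂' M').Adj x y := by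
    intro x y
    have h' : joinGraph H₁ H₂ M = joinGraph H₁' H₂' M' := h
    rw [h']
  have e1 : H₁ = H₁' := by
    ext a b
    exact hadj (.inl a) (.inl b)
  have e2 : H₂ = H₂' := by
    ext a b
    exact hadj (.inr a) (.inr b)
  have e3 : M = M' := by
    ext ⟨a, b⟩
    exact hadj (.inl a) (.inr b)
  rw [e1, e2, e3]

lemma sideSign_eq (b : Bool) : sideSign b = 1 ∨ sideSign b = -1 := by
  cases b <;> simp [sideSign]

lemma sub_le_sign_mul_add {x y r t s s' : ℝ} (hs : s = 1 ∨ s = -1) (hs' : s' = 1 ∨ s' = -1)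
    (hx : t ≤ s * x) (hy : |y| ≤ r) : t - r ≤ s * (x + s' * y) := by
  have h := abs_le.1 hy
  rcases hs with rfl | rfl <;> rcases hs' with rfl | rfl <;> linarith [h.1, h.2]

lemma adjInd_joinGraph_inl_inr {U W : Type} [DecidableEq U] [DecidableEq W]
    (H₁ : SimpleGraph U) (H₂ : SimpleGraph W) (M : Finset (U × W)) (a : U) (b : W) :
    adjInd (joinGraph H₁ H₂ M) (.inl a) (.inr b) = if (a, b) ∈ M then 1 else 0 :=
  by classical exact if_congr Iff.rfl rfl rfl

lemma adjInd_joinGraph_inr_inl {U W : Type} [DecidableEq U] [DecidableEq W]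
    (H₁ : SimpleGraph U) (H₂ : SimpleGraph W) (M : Finset (U × W)) (a : U) (b : W) :
    adjInd (joinGraph H₁ H₂ M) (.inr b) (.inl a) = if (a, b) ∈ M then 1 else 0 :=
  by classical exact if_congr Iff.rfl rfl rfl

lemma le_signed_degree_joinGraph {p q n : ℕ} (H₁ : SimpleGraph (Bool × Fin p))
    (H₂ : SimpleGraph (Bool × Fin q)) (M : Finset ((Bool × Fin p) × (Bool × Fin q))) {t : ℝ}
    (h₁ : ∀ v, t ≤ sideSign v.1 * ∑ w, sideSign w.1 * adjInd H₁ v w)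
    (h₂ : ∀ v, t ≤ sideSign v.1 * ∑ w, sideSign w.1 * adjInd H₂ v w)
    (hM : M ∈ balancedBipartite p q n) (s : ℝ) (hs : s = 1 ∨ s = -1)
    (τ : (Bool × Fin p) ⊕ (Bool × Fin q) → ℝ) (hτ₁ : ∀ a, τ (.inl a) = sideSign a.1)
    (hτ₂ : ∀ b, τ (.inr b) = s * sideSign b.1) (v) :
    t - √n ≤ τ v * ∑ w, τ w * adjInd (joinGraph H₁ H₂ M) v w := by
  classical
  obtain ⟨hM₁, hM₂⟩ := (mem_filter.1 hM).2
  rw [Fintype.sum_sum_type]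
  simp_rw [hτ₁, hτ₂]
  rcases v with a | b
  · rw [hτ₁]
    simp_rw [mul_assoc, ← mul_sum]
    refine sub_le_sign_mul_add (sideSign_eq _) hs ?_ ?_
    · exact h₁ a
    · simp_rw [adjInd_joinGraph_inl_inr]
      exact hM₁ a
  · rw [hτ₂]
    simp_rw [mul_assoc, ← mul_sum]
    have key := sub_le_sign_mul_add (sideSign_eq b.1) hs (h₂ b) (hM₂ b)
    have e : ∀ x y : ℝ, s * (sideSign b.1 * (x + s * y)) = sideSign b.1 * (y + s * x) := by
      intro x y
      rcases hs with rfl | rfl <;> ring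
    rw [e]
    simp_rw [adjInd_joinGraph_inr_inl]
    exact key

lemma exists_equiv_four_parts {p q n : ℕ} (hpq : p + q = n) (A B : Finset (Fin (2 * n)))
    (hA : A.card = n) (hB : B.card = n) (hAB : (A ∩ B).card = p) :
    ∃ e : Fin (2 * n) ≃ (Bool × Fin p) ⊕ (Bool × Fin q),
      (∀ v, (if v ∈ A then (1 : ℝ) else -1) =
        Sum.elim (fun u => sideSign u.1) (fun u => sideSign u.1) (e v)) ∧
      ∀ v, (if v ∈ B then (1 : ℝ) else -1) =
        Sum.elim (fun u => sideSign u.1) (fun u => -1 * sideSign u.1) (e v) := by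
  classical
  set f : Fin (2 * n) → Bool × Bool := fun v => (decide (v ∈ A), decide (v ∈ B)) with hf
  set g : (Bool × Fin p) ⊕ (Bool × Fin q) → Bool × Bool :=
    Sum.elim (fun u => (u.1, u.1)) (fun u => (u.1, !u.1)) with hg
  have hAsd := card_sdiff_add_card_inter A B
  have hBsd := card_sdiff_add_card_inter B A
  have hunion := card_union_add_card_inter A B
  have hcompl := card_compl (A ∪ B)
  have hle := card_le_univ (A ∪ B)
  rw [inter_comm B A] at hBsd
  rw [Fintype.card_fin] at hcompl hle
  have hcard : ∀ x, Fintype.card {v // f v = x} = Fintype.card {u // g u = x} := by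
    intro x
    have hgc : Fintype.card {u // g u = x} = if x.1 = x.2 then p else q := by
      rw [Fintype.card_subtype, card_filter, Fintype.sum_sum_type, Fintype.sum_prod_type,
        Fintype.sum_prod_type]
      rcases x with ⟨_ | _, _ | _⟩ <;> simp [hg]
    rw [hgc, Fintype.card_subtype]
    rcases x with ⟨_ | _, _ | _⟩
    · have : (univ.filter fun v => f v = (false, false)) = (A ∪ B)ᶜ := by
        ext v; simp [hf]
      rw [this, if_pos rfl]; omega
    · have : (univ.filter fun v => f v = (false, true)) = B \ A := by
        ext v; simp [hf, and_comm]
      rw [this, if_neg (by simp)]; omega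
    · have : (univ.filter fun v => f v = (true, false)) = A \ B := by
        ext v; simp [hf]
      rw [this, if_neg (by simp)]; omega
    · have : (univ.filter fun v => f v = (true, true)) = A ∩ B := by
        ext v; simp [hf]
      rw [this, if_pos rfl]; omega
  refine ⟨Equiv.ofFiberEquiv fun x => Fintype.equivOfCardEq (hcard x), fun v => ?_, fun v => ?_⟩
  all_goals
    have h := Equiv.ofFiberEquiv_map (fun x => Fintype.equivOfCardEq (hcard x)) v
    set u := Equiv.ofFiberEquiv (fun x => Fintype.equivOfCardEq (hcard x)) v
    have h1 : (g u).1 = decide (v ∈ A) := by rw [h]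
    have h2 : (g u).2 = decide (v ∈ B) := by rw [h]
    rcases u with ⟨_ | _, _⟩ | ⟨_ | _, _⟩ <;> simp [hg] at h1 h2 <;> simp [sideSign, h1, h2]

lemma sum_mul_adjInd_comap {V W : Type} [Fintype V] [Fintype W] (e : V ≃ W)
    (G : SimpleGraph W) (τ : W → ℝ) (v : V) :
    ∑ w, τ (e w) * adjInd (G.comap e) v w = ∑ w, τ w * adjInd G (e v) w := by
  rw [← e.sum_comp]
  rfl

lemma card_mul_le_card_friendlyPair {p q n : ℕ} (hpq : p + q = n) (A B : Finset (Fin (2 * n)))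
    (hA : A.card = n) (hB : B.card = n) (hAB : (A ∩ B).card = p) (γ : ℝ) (hγ : γ ≤ 1) :
    Nat.card {H : SimpleGraph (Bool × Fin p) //
        ∀ v, 2 * √n ≤ sideSign v.1 * ∑ w, sideSign w.1 * adjInd H v w} *
      (Nat.card {H : SimpleGraph (Bool × Fin q) //
        ∀ v, 2 * √n ≤ sideSign v.1 * ∑ w, sideSign w.1 * adjInd H v w} *
      (balancedBipartite p q n).card) ≤
    Nat.card {G : SimpleGraph (Fin (2 * n)) //
      FriendlyPair G A (γ * √n) ∧ FriendlyPair G B (γ * √n)} := by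
  obtain ⟨e, heA, heB⟩ := exists_equiv_four_parts hpq A B hA hB hAB
  have hγn : γ * √n ≤ 2 * √n - √n := by nlinarith [Real.sqrt_nonneg (n : ℝ)]
  rw [← Nat.card_eq_finsetCard, ← Nat.card_prod, ← Nat.card_prod]
  refine Nat.card_le_card_of_injective (fun x =>
    ⟨(joinGraph x.1.1 x.2.1.1 x.2.2.1).comap e, ?_, ?_⟩) fun x y hxy => ?_
  · refine friendlyPair_of_le_signed_degree _ _ _ fun v => hγn.trans ?_
    simp_rw [heA]
    rw [sum_mul_adjInd_comap]
    exact le_signed_degree_joinGraph _ _ _ x.1.2 x.2.1.2 x.2.2.2 1 (.inl rfl) _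
      (fun _ => rfl) (fun _ => (one_mul _).symm) _
  · refine friendlyPair_of_le_signed_degree _ _ _ fun v => hγn.trans ?_
    simp_rw [heB]
    rw [sum_mul_adjInd_comap]
    exact le_signed_degree_joinGraph _ _ _ x.1.2 x.2.1.2 x.2.2.2 (-1) (.inr rfl) _
      (fun _ => rfl) (fun _ => rfl) _
  · have h := joinGraph_injective (a₁ := (x.1.1, x.2.1.1, x.2.2.1))
      (a₂ := (y.1.1, y.2.1.1, y.2.2.1))
      (e.simpleGraph.symm.injective (congrArg Subtype.val hxy))
    simp only [Prod.mk.injEq] at h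
    exact Prod.ext (Subtype.ext h.1) (Prod.ext (Subtype.ext h.2.1) (Subtype.ext h.2.2))

lemma exists_exp_le_graphProb_friendlyPair (c : ℝ) (hc : 0 < c) :
    ∃ κ : ℝ, ∃ n₀ : ℕ, ∀ n : ℕ, n₀ ≤ n → ∀ γ : ℝ, γ ≤ 1 →
      ∀ A B : Finset (Fin (2 * n)), A.card = n → B.card = n →
        c * n ≤ ((A ∩ B).card : ℝ) → ((A ∩ B).card : ℝ) ≤ (1 - c) * n →
        Real.exp (-κ * n) ≤ graphProb (2 * n) (fun G =>
          FriendlyPair G A (γ * √n) ∧ FriendlyPair G B (γ * √n)) := by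
  obtain ⟨δ, hδ, d₀, hd⟩ := exists_le_card_signed_degree_ge (5 / √c) (by positivity)
  obtain ⟨κ, -, hκ⟩ := exists_exp_mul_le_card_balancedBipartite
  refine ⟨κ - 2 * Real.log δ, max 1 ⌈((d₀ : ℝ) + 1) / c⌉₊,
    fun n hn γ hγ A B hA hB hc1 hc2 => ?_⟩
  have hn0 : 0 < n := le_trans (le_max_left _ _) hn
  have hn1 : (1 : ℝ) ≤ n := by exact_mod_cast hn0
  have hnd : (d₀ : ℝ) + 1 ≤ c * n := by
    have := (Nat.le_ceil _).trans (Nat.cast_le.2 ((le_max_right _ _).trans hn) : _ ≤ (n : ℝ))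
    rwa [div_le_iff₀ hc, mul_comm] at this
  obtain ⟨q, hq'⟩ := Nat.exists_eq_add_of_le 
    ((card_le_card (inter_subset_left (s₂ := B))).trans_eq hA)
  have hq := hq'.symm
  set p := (A ∩ B).card with hp
  have hqn : c * n ≤ (q : ℝ) := by
    have : (p : ℝ) + q = n := by exact_mod_cast hq
    linarith
  have hblock : ∀ r : ℕ, c * n ≤ (r : ℝ) →
      (2 : ℝ) ^ (2 * r).choose 2 * δ ^ (2 * r) ≤
        (Nat.card {H : SimpleGraph (Bool × Fin r) //
          ∀ v, 2 * √n ≤ sideSign v.1 * ∑ w, sideSign w.1 * adjInd H v w} : ℝ) := by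
    intro r hr
    have hdr : d₀ + 1 ≤ r := by exact_mod_cast hnd.trans hr
    have hcard : Fintype.card (Bool × Fin r) = 2 * r := by simp
    have h := hd (Bool × Fin r) (fun v => sideSign v.1) (fun v => sideSign_eq _)
      (by rw [Fintype.sum_prod_type]; simp [sideSign]) (by rw [hcard]; omega)
    rw [hcard, Sym2.card_subtype_not_diag, hcard] at h
    refine h.trans (Nat.cast_le.2 (Nat.card_le_card_of_injective
      (Subtype.map id fun H hH v => le_trans ?_ (hH v))
      (Subtype.map_injective _ Function.injective_id)))
    have h1 : √c * √n ≤ √((2 * r - 1 : ℕ) : ℝ) := by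
      rw [← Real.sqrt_mul hc.le]
      refine Real.sqrt_le_sqrt (hr.trans ?_)
      exact_mod_cast (by omega : r ≤ 2 * r - 1)
    have h2 : 5 * √n ≤ 5 / √c * √((2 * r - 1 : ℕ) : ℝ) := by
      have hsc : 0 < √c := Real.sqrt_pos.2 hc
      calc 5 * √n = 5 / √c * (√c * √n) := by field_simp
        _ ≤ _ := by gcongr
    have h3 : 1 ≤ √(n : ℝ) := Real.one_le_sqrt.2 hn1
    linarith
  have hchoose : (2 * n).choose 2 = (2 * p).choose 2 + (2 * q).choose 2 + p * q * 4 := by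
    have hnq : (n : ℚ) = p + q := by exact_mod_cast hq.symm
    have h : (((2 * n).choose 2 : ℕ) : ℚ) =
        ((2 * p).choose 2 + (2 * q).choose 2 + p * q * 4 : ℕ) := by
      push_cast [Nat.cast_choose_two, hnq]
      ring
    exact_mod_cast h
  have hδn : δ ^ (2 * n) = Real.exp (2 * Real.log δ * n) := by
    rw [← Real.exp_log hδ, ← Real.exp_nat_mul, Real.exp_log hδ]
    push_cast
    ring_nf
  rw [graphProb, le_div_iff₀ (by positivity)]
  calc Real.exp (-(κ - 2 * Real.log δ) * n) * 2 ^ (2 * n).choose 2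
      = (2 ^ (2 * p).choose 2 * δ ^ (2 * p)) * ((2 ^ (2 * q).choose 2 * δ ^ (2 * q)) *
          (Real.exp (-κ * n) * (2 ^ (p * q)) ^ 4)) := by
        have h1 : Real.exp (-(κ - 2 * Real.log δ) * n) = Real.exp (-κ * n) * δ ^ (2 * n) := by
          rw [hδn, ← Real.exp_add]
          ring_nf
        have h2 : δ ^ (2 * n) = δ ^ (2 * p) * δ ^ (2 * q) := by
          rw [← pow_add, ← mul_add, hq]
        rw [h1, h2, hchoose, pow_add, pow_add, pow_mul _ (p * q)]
        ring
    _ ≤ _ := mul_le_mul (hblock p hc1) (mul_le_mul (hblock q hqn)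
          (hκ p q n hn0 (by omega) (by omega)) (by positivity) (by positivity))
          (by positivity) (by positivity)
    _ ≤ _ := by exact_mod_cast card_mul_le_card_friendlyPair hq A B hA hB hp.symm γ hγ

lemma graphProb_le_and_add_not {m : ℕ} (P Q : SimpleGraph (Fin m) → Prop) :
    graphProb m P ≤ graphProb m (fun G => P G ∧ Q G) + graphProb m (fun G => ¬Q G) := by
  classical
  rw [graphProb, graphProb, graphProb, ← add_div]
  gcongr
  simp_rw [natCard_graph_eq]
  rw [← Nat.cast_add, Nat.cast_le]
  refine (card_le_card fun T hT => ?_).trans (card_union_le _ _)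
  by_cases h : Q (graphOf T)
  · exact mem_union_left _ (mem_filter.2 ⟨mem_univ _, (mem_filter.1 hT).2, h⟩)
  · exact mem_union_right _ (mem_filter.2 ⟨mem_univ _, h⟩)

end

/-- For every `c > 0` there are `K > 0` and `n₀` such that for all
`n ≥ n₀`, `γ ∈ [−1,1]`, and bisections `A ∪ Aᶜ`, `B ∪ Bᶜ` of `[2n]` with
`cn ≤ |A ∩ B| ≤ (1−c)n`: for `G ∼ G(2n,1/2)`,
`P[E_var | E₂] ≥ 1 − exp(−n)`, stated as `P[E_var ∧ E₂] ≥ (1 − exp(−n)) · P[E₂]`,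
where `E_var` is the event `Σ_v (deg(v,S) − |S|/2)² ≤ K n²` for all `S ⊆ [2n]`. -/
theorem degree_variance_conditional_on_friendly :
    ∀ c : ℝ, 0 < c → ∃ K : ℝ, 0 < K ∧ ∃ n₀ : ℕ, ∀ n : ℕ, n₀ ≤ n →
      ∀ γ : ℝ, |γ| ≤ 1 →
      ∀ A B : Finset (Fin (2 * n)), A.card = n → B.card = n →
        c * n ≤ ((A ∩ B).card : ℝ) → ((A ∩ B).card : ℝ) ≤ (1 - c) * n →
        (1 - Real.exp (-(n : ℝ))) *
            graphProb (2 * n) (fun G =>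
              FriendlyPair G A (γ * Real.sqrt n) ∧ FriendlyPair G B (γ * Real.sqrt n)) ≤
          graphProb (2 * n) (fun G =>
            (FriendlyPair G A (γ * Real.sqrt n) ∧ FriendlyPair G B (γ * Real.sqrt n)) ∧
            ∀ S : Finset (Fin (2 * n)),
              ∑ v : Fin (2 * n), ((degIn G v S : ℝ) - (S.card : ℝ) / 2) ^ 2
                ≤ K * (n : ℝ) ^ 2) := by
  intro c hc
  obtain ⟨κ, n₀, hlow⟩ := exists_exp_le_graphProb_friendlyPair c hc
  obtain ⟨K, hK, hvar⟩ := exists_graphProb_degree_variance_le (κ + 1)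
  refine ⟨K, hK, max n₀ 1, fun n hn γ hγ A B hA hB h₁ h₂ => ?_⟩
  have hE := hlow n (le_trans (le_max_left _ _) hn) γ (le_of_abs_le hγ) A B hA hB h₁ h₂
  have hV := hvar n (le_trans (le_max_right _ _) hn)
  have hsplit := graphProb_le_and_add_not (fun G : SimpleGraph (Fin (2 * n)) =>
    FriendlyPair G A (γ * √n) ∧ FriendlyPair G B (γ * √n))
    (fun G => ∀ S : Finset (Fin (2 * n)),
      ∑ v : Fin (2 * n), ((degIn G v S : ℝ) - (S.card : ℝ) / 2) ^ 2 ≤ K * (n : ℝ) ^ 2)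
  have hexp : Real.exp (-(κ + 1) * n) = Real.exp (-(n : ℝ)) * Real.exp (-κ * n) := by
    rw [← Real.exp_add]
    ring_nf
  have hmul := mul_le_mul_of_nonneg_left hE (Real.exp_nonneg (-(n : ℝ)))
  rw [hexp] at hV
  linarith
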